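/- arXiv:2508.02715 — 6 statements merged into one kernel-verified Lean document; each statement's English description precedes it below -/
import Mathlib

section
/- Let n ≥ 1, let ε ∈ {±1}ⁿ be a sign pattern, and fix a matrix B_ε ∈ LPM_n(ε). Then for every A ∈ LPM_n(ε) there exists a unique real lower triangular matrix L with strictly positive diagonal entries such that A = L·B_ε·Lᵀ. In particular, the map L ↦ L·B_ε·Lᵀ is a bijection from L_n onto LPM_n(ε). -/
open Matrix

/-- The leading principal `k × k` minor (size `k.val + 1` for `k : Fin n`). -/
def leadingMinor {n : ℕ} (A : Matrix (Fin n) (Fin n) ℝ) (k : Fin n) : ℝ :=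
  (A.submatrix (Fin.castLE k.isLt : Fin (k.val + 1) → Fin n)
    (Fin.castLE k.isLt : Fin (k.val + 1) → Fin n)).det

/-- `A ∈ LPM_n(ε)`: `A` is symmetric and its leading principal `k × k` minor is nonzero
with sign `ε k`, for each `1 ≤ k ≤ n`. -/
def memLPM {n : ℕ} (ε : Fin n → ℝ) (A : Matrix (Fin n) (Fin n) ℝ) : Prop :=
  A.IsSymm ∧ ∀ k : Fin n, 0 < ε k * leadingMinor A k

/-- Membership in Cholesky space `L_n`: lower triangular with strictly positive diagonal. -/
def InCholSpace {n : ℕ} (L : Matrix (Fin n) (Fin n) ℝ) : Prop :=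
  (∀ i j : Fin n, i < j → L i j = 0) ∧ ∀ j, 0 < L j j

/-- Deleting the last row and column of a square matrix. -/
def truncLast {n : ℕ} (A : Matrix (Fin (n + 1)) (Fin (n + 1)) ℝ) : Matrix (Fin n) (Fin n) ℝ :=
  A.submatrix Fin.castSucc Fin.castSucc

@[simp]
lemma truncLast_apply {n : ℕ} (A : Matrix (Fin (n + 1)) (Fin (n + 1)) ℝ) (i j : Fin n) :
    truncLast A i j = A i.castSucc j.castSucc := rfl

lemma isSymm_truncLast {n : ℕ} {A : Matrix (Fin (n + 1)) (Fin (n + 1)) ℝ} (hA : A.IsSymm) :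
    (truncLast A).IsSymm := hA.submatrix _

lemma leadingMinor_last {n : ℕ} (A : Matrix (Fin (n + 1)) (Fin (n + 1)) ℝ) :
    leadingMinor A (Fin.last n) = A.det := rfl

lemma leadingMinor_castSucc {n : ℕ} (A : Matrix (Fin (n + 1)) (Fin (n + 1)) ℝ) (k : Fin n) :
    leadingMinor A k.castSucc = leadingMinor (truncLast A) k := rfl

lemma det_mul_det_pos {n : ℕ} {A B : Matrix (Fin n) (Fin n) ℝ}
    (h : ∀ k, 0 < leadingMinor A k * leadingMinor B k) : 0 < A.det * B.det := by
  cases n with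
  | zero => simp
  | succ n => exact h (Fin.last n)

lemma InCholSpace.det_pos {n : ℕ} {L : Matrix (Fin n) (Fin n) ℝ} (h : InCholSpace L) :
    0 < L.det := by
  rw [det_of_isLowerTriangular L fun i j hij => h.1 i j hij]
  exact Finset.prod_pos fun i _ => h.2 i

lemma InCholSpace.truncLast {n : ℕ} {L : Matrix (Fin (n + 1)) (Fin (n + 1)) ℝ}
    (h : InCholSpace L) : InCholSpace (truncLast L) :=
  ⟨fun _ _ hij => h.1 _ _ (Fin.castSucc_lt_castSucc_iff.2 hij), fun _ => h.2 _⟩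

lemma InCholSpace.det_eq {n : ℕ} {L : Matrix (Fin (n + 1)) (Fin (n + 1)) ℝ}
    (h : InCholSpace L) :
    L.det = (_root_.truncLast L).det * L (Fin.last n) (Fin.last n) := by
  rw [det_of_isLowerTriangular L fun i j hij => h.1 i j hij,
    det_of_isLowerTriangular _ fun i j hij => h.truncLast.1 i j hij, Fin.prod_univ_castSucc]
  rfl

lemma InCholSpace.truncLast_congr {n : ℕ} {L : Matrix (Fin (n + 1)) (Fin (n + 1)) ℝ}
    (h : InCholSpace L) (B : Matrix (Fin (n + 1)) (Fin (n + 1)) ℝ) :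
    _root_.truncLast (L * B * Lᵀ) =
      _root_.truncLast L * _root_.truncLast B * (_root_.truncLast L)ᵀ := by
  have h0 (i : Fin n) : L i.castSucc (Fin.last n) = 0 := h.1 _ _ (Fin.castSucc_lt_last i)
  ext i j
  simp [mul_apply, Fin.sum_univ_castSucc, h0]

lemma InCholSpace.congr_lastCol {n : ℕ} {L : Matrix (Fin (n + 1)) (Fin (n + 1)) ℝ}
    (h : InCholSpace L) (B : Matrix (Fin (n + 1)) (Fin (n + 1)) ℝ) :
    (fun i : Fin n => (L * B * Lᵀ) i.castSucc (Fin.last n)) =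
      _root_.truncLast L *ᵥ (_root_.truncLast B *ᵥ (fun j => L (Fin.last n) j.castSucc) +
        L (Fin.last n) (Fin.last n) • fun j : Fin n => B j.castSucc (Fin.last n)) := by
  have h0 (i : Fin n) : L i.castSucc (Fin.last n) = 0 := h.1 _ _ (Fin.castSucc_lt_last i)
  rw [mulVec_add, mulVec_mulVec, mulVec_smul]
  ext i
  simp [mul_apply, mulVec, dotProduct, Fin.sum_univ_castSucc, h0, mul_comm]

lemma det_congr {n : ℕ} (L B : Matrix (Fin n) (Fin n) ℝ) :
    (L * B * Lᵀ).det = L.det ^ 2 * B.det := by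
  rw [det_mul, det_mul, det_transpose]; ring

lemma leadingMinor_congr {n : ℕ} {L : Matrix (Fin n) (Fin n) ℝ} (h : InCholSpace L)
    (B : Matrix (Fin n) (Fin n) ℝ) (k : Fin n) :
    leadingMinor (L * B * Lᵀ) k = leadingMinor L k ^ 2 * leadingMinor B k := by
  induction n with
  | zero => exact k.elim0
  | succ n ih =>
    induction k using Fin.lastCases with
    | last => simp only [leadingMinor_last, det_congr]
    | cast k => simp only [leadingMinor_castSucc, h.truncLast_congr, ih h.truncLast]

lemma InCholSpace.leadingMinor_pos {n : ℕ} {L : Matrix (Fin n) (Fin n) ℝ} (h : InCholSpace L)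
    (k : Fin n) : 0 < leadingMinor L k :=
  InCholSpace.det_pos
    ⟨fun _ _ hij => h.1 _ _ (Fin.strictMono_castLE k.isLt hij), fun _ => h.2 _⟩

lemma isSymm_congr {n : ℕ} (L : Matrix (Fin n) (Fin n) ℝ) {B : Matrix (Fin n) (Fin n) ℝ}
    (hB : B.IsSymm) : (L * B * Lᵀ).IsSymm := by
  rw [IsSymm, transpose_mul, transpose_mul, transpose_transpose, hB.eq, Matrix.mul_assoc]

/-- The lower triangular matrix with blocks `M`, `0`, `w`, `l`. -/
def borderLower {n : ℕ} (M : Matrix (Fin n) (Fin n) ℝ) (w : Fin n → ℝ) (l : ℝ) :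
    Matrix (Fin (n + 1)) (Fin (n + 1)) ℝ :=
  of <| Fin.snoc (α := fun _ => Fin (n + 1) → ℝ)
    (fun i => Fin.snoc (α := fun _ => ℝ) (fun j => M i j) 0) (Fin.snoc (α := fun _ => ℝ) w l)

lemma inCholSpace_borderLower {n : ℕ} {M : Matrix (Fin n) (Fin n) ℝ} (hM : InCholSpace M)
    (w : Fin n → ℝ) {l : ℝ} (hl : 0 < l) : InCholSpace (borderLower M w l) := by
  constructor
  · intro i j hij
    induction i using Fin.lastCases with
    | last => exact absurd hij (Fin.le_last j).not_gt
    | cast i =>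
      induction j using Fin.lastCases with
      | last => simp [borderLower]
      | cast j => simpa [borderLower] using hM.1 i j (Fin.castSucc_lt_castSucc_iff.1 hij)
  · intro j
    induction j using Fin.lastCases with
    | last => simpa [borderLower] using hl
    | cast j => simpa [borderLower] using hM.2 j

/-- A symmetric matrix with nonsingular truncation is determined by its truncation, its last
column and its determinant. -/
lemma Matrix.IsSymm.eq_of_truncLast {n : ℕ} {A C : Matrix (Fin (n + 1)) (Fin (n + 1)) ℝ}
    (hA : A.IsSymm) (hC : C.IsSymm) (h : truncLast A = truncLast C)
    (hcol : ∀ i : Fin n, A i.castSucc (Fin.last n) = C i.castSucc (Fin.last n))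
    (hdet : A.det = C.det) (hne : (truncLast A).det ≠ 0) : A = C := by
  have hsub (i j : Fin n) : A i.castSucc j.castSucc = C i.castSucc j.castSucc :=
    congrFun (congrFun h i) j
  have hrow (i : Fin n) : A (Fin.last n) i.castSucc = C (Fin.last n) i.castSucc := by
    rw [← hA.apply, ← hC.apply, hcol]
  have hminor (i : Fin (n + 1)) :
      A.submatrix (Fin.last n).succAbove i.succAbove =
        C.submatrix (Fin.last n).succAbove i.succAbove := by
    ext a b
    simp only [submatrix_apply, Fin.succAbove_last]
    induction i.succAbove b using Fin.lastCases with
    | last => exact hcol a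
    | cast j => exact hsub a j
  have hcorner : A (Fin.last n) (Fin.last n) = C (Fin.last n) (Fin.last n) := by
    rw [det_succ_row A (Fin.last n), det_succ_row C (Fin.last n), Fin.sum_univ_castSucc,
      Fin.sum_univ_castSucc] at hdet
    simp only [hrow, hminor] at hdet
    rw [add_right_inj] at hdet
    have hne' : (C.submatrix (Fin.last n).succAbove (Fin.last n).succAbove).det ≠ 0 := by
      rw [← hminor, Fin.succAbove_last]
      exact hne
    refine mul_left_cancel₀ (a := (-1 : ℝ) ^ ((Fin.last n : ℕ) + (Fin.last n : ℕ))) (by simp) ?_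
    exact mul_right_cancel₀ hne' hdet
  ext i j
  induction i using Fin.lastCases with
  | last =>
    induction j using Fin.lastCases with
    | last => exact hcorner
    | cast j => exact hrow j
  | cast i =>
    induction j using Fin.lastCases with
    | last => exact hcol i
    | cast j => exact hsub i j

lemma existsUnique_cholesky {n : ℕ} {A B : Matrix (Fin n) (Fin n) ℝ} (hA : A.IsSymm)
    (hB : B.IsSymm) (h : ∀ k, 0 < leadingMinor A k * leadingMinor B k) :
    ∃! L, InCholSpace L ∧ A = L * B * Lᵀ := by
  induction n with
  | zero =>
    exact ⟨0, ⟨⟨fun i => i.elim0, fun i => i.elim0⟩, Subsingleton.elim _ _⟩,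
      fun _ _ => Subsingleton.elim _ _⟩
  | succ n ih =>
    have h' : ∀ k, 0 < leadingMinor (truncLast A) k * leadingMinor (truncLast B) k :=
      fun k => h k.castSucc
    obtain ⟨M, ⟨hM, hAM⟩, hMu⟩ := ih (isSymm_truncLast hA) (isSymm_truncLast hB) h'
    have hdet := det_mul_det_pos h
    have hdet' := det_mul_det_pos h'
    have hB0 : B.det ≠ 0 := right_ne_zero_of_mul hdet.ne'
    have hA'0 : (truncLast A).det ≠ 0 := left_ne_zero_of_mul hdet'.ne'
    have hB' : IsUnit (truncLast B).det := (right_ne_zero_of_mul hdet'.ne').isUnit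
    have hM' : IsUnit M.det := hM.det_pos.ne'.isUnit
    have hq : 0 < A.det / B.det := by
      rw [← mul_div_mul_right _ _ hB0]
      exact div_pos hdet (mul_self_pos.2 hB0)
    set l := √(A.det / B.det) / M.det with hl
    have hl0 : 0 < l := div_pos (Real.sqrt_pos.2 hq) hM.det_pos
    set b : Fin n → ℝ := fun j => B j.castSucc (Fin.last n)
    set v : Fin n → ℝ := fun j => A j.castSucc (Fin.last n) with hv
    set w := (truncLast B)⁻¹ *ᵥ (M⁻¹ *ᵥ v - l • b) with hw
    refine ⟨borderLower M w l, ⟨inCholSpace_borderLower hM w hl0, ?_⟩, ?_⟩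
    · have hL := inCholSpace_borderLower hM w hl0
      have htr : truncLast (borderLower M w l) = M := by
        ext i j; simp [borderLower]
      have hlast : borderLower M w l (Fin.last n) (Fin.last n) = l := by simp [borderLower]
      have hrow : (fun j : Fin n => borderLower M w l (Fin.last n) j.castSucc) = w := by
        ext j; simp [borderLower]
      refine IsSymm.eq_of_truncLast hA (isSymm_congr _ hB) ?_ (congrFun ?_) ?_ hA'0
      · rw [hL.truncLast_congr, htr, hAM]
      · rw [hL.congr_lastCol, htr, hlast, hrow, hw, mulVec_mulVec, mul_nonsing_inv _ hB',
          one_mulVec, sub_add_cancel, mulVec_mulVec, mul_nonsing_inv _ hM', one_mulVec]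
      · rw [det_congr, hL.det_eq, htr, hlast, hl, mul_div_cancel₀ _ hM.det_pos.ne',
          Real.sq_sqrt hq.le, div_mul_cancel₀ _ hB0]
    · rintro L ⟨hL, hAL⟩
      have htr : truncLast L = M := hMu _ ⟨hL.truncLast, by rw [← hL.truncLast_congr, ← hAL]⟩
      have hlast : L (Fin.last n) (Fin.last n) = l := by
        have hLdet := hL.det_eq
        rw [htr] at hLdet
        rw [hl, eq_div_iff hM.det_pos.ne', mul_comm, ← hLdet, hAL, det_congr,
          mul_div_cancel_right₀ _ hB0, Real.sqrt_sq hL.det_pos.le]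
      have hrow : (fun j : Fin n => L (Fin.last n) j.castSucc) = w := by
        have hcol := hL.congr_lastCol B
        rw [← hAL, htr, hlast, ← hv] at hcol
        rw [hw, hcol, mulVec_mulVec, nonsing_inv_mul _ hM', one_mulVec, add_sub_cancel_right,
          mulVec_mulVec, nonsing_inv_mul _ hB', one_mulVec]
      ext i j
      induction i using Fin.lastCases with
      | last =>
        induction j using Fin.lastCases with
        | last => simpa [borderLower] using hlast
        | cast j => simpa [borderLower] using congrFun hrow j
      | cast i =>
        induction j using Fin.lastCases with
        | last => simpa [borderLower] using hL.1 _ _ (Fin.castSucc_lt_last i)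
        | cast j => simpa [borderLower] using congrFun (congrFun htr i) j

lemma memLPM.congr {n : ℕ} {ε : Fin n → ℝ} {B L : Matrix (Fin n) (Fin n) ℝ} (hB : memLPM ε B)
    (hL : InCholSpace L) : memLPM ε (L * B * Lᵀ) := by
  refine ⟨isSymm_congr L hB.1, fun k => ?_⟩
  rw [leadingMinor_congr hL, mul_left_comm]
  exact mul_pos (pow_pos (hL.leadingMinor_pos k) 2) (hB.2 k)

lemma memLPM.leadingMinor_mul_pos {n : ℕ} {ε : Fin n → ℝ} {A B : Matrix (Fin n) (Fin n) ℝ}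
    (hA : memLPM ε A) (hB : memLPM ε B) (k : Fin n) :
    0 < leadingMinor A k * leadingMinor B k := by
  have h := mul_pos (hA.2 k) (hB.2 k)
  rw [mul_mul_mul_comm] at h
  exact pos_of_mul_pos_right h (mul_self_nonneg _)

/-- Fix `B ∈ LPM_n(ε)`.  Every `A ∈ LPM_n(ε)` admits a unique
Cholesky-type factorization `A = L * B * Lᵀ` with `L ∈ L_n`; in particular
`L ↦ L * B * Lᵀ` is a bijection from `L_n` onto `LPM_n(ε)`. -/
theorem stmt2 (n : ℕ) (hn : 1 ≤ n) (ε : Fin n → ℝ)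
    (hε : ∀ k, ε k = 1 ∨ ε k = -1)
    (B : Matrix (Fin n) (Fin n) ℝ) (hB : memLPM ε B) :
    (∀ A : Matrix (Fin n) (Fin n) ℝ, memLPM ε A →
      ∃! L : Matrix (Fin n) (Fin n) ℝ, InCholSpace L ∧ A = L * B * Lᵀ) ∧
    Set.BijOn (fun L => L * B * Lᵀ) {L | InCholSpace L} {A | memLPM ε A} := by
  have key : ∀ A : Matrix (Fin n) (Fin n) ℝ, memLPM ε A →
      ∃! L : Matrix (Fin n) (Fin n) ℝ, InCholSpace L ∧ A = L * B * Lᵀ := fun A hA =>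
    existsUnique_cholesky hA.1 hB.1 (hA.leadingMinor_mul_pos hB)
  refine ⟨key, fun L hL => hB.congr hL, fun L hL M hM hLM => ?_, fun A hA => ?_⟩
  · exact (key _ (hB.congr hL)).unique ⟨hL, rfl⟩ ⟨hM, hLM⟩
  · obtain ⟨L, ⟨hL, hAL⟩, -⟩ := key A hA
    exact ⟨L, hL, hAL.symm⟩
end

section
/- Let n ≥ 1 and let ε ∈ {±1}ⁿ be a sign pattern. Fix a complex Hermitian n × n matrix B_ε whose leading principal k × k minor (which is real since B_ε is Hermitian) is nonzero with sign ε_k for each 1 ≤ k ≤ n. Then for every complex Hermitian n × n matrix A whose leading principal k × k minor is nonzero with sign ε_k for each 1 ≤ k ≤ n, there exists a unique complex lower triangular matrix L whose diagonal entries are strictly positive real numbers such that A = L·B_ε·L*, where L* denotes the conjugate transpose. -/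
open Matrix

/-- The leading principal `k × k` minor (size `k.val + 1` for `k : Fin n`) of a complex
matrix. -/
def leadingMinorC {n : ℕ} (A : Matrix (Fin n) (Fin n) ℂ) (k : Fin n) : ℂ :=
  (A.submatrix (Fin.castLE k.isLt : Fin (k.val + 1) → Fin n)
    (Fin.castLE k.isLt : Fin (k.val + 1) → Fin n)).det

/-- `A ∈ LPM_n^ℂ(ε)`: `A` is Hermitian and each leading principal `k × k` minor is a real
number which is nonzero with sign `ε k`. -/
def memLPMC {n : ℕ} (ε : Fin n → ℝ) (A : Matrix (Fin n) (Fin n) ℂ) : Prop :=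
  A.IsHermitian ∧ ∀ k : Fin n,
    (leadingMinorC A k).im = 0 ∧ 0 < ε k * (leadingMinorC A k).re

theorem det_fromBlocks_smul_one {m : Type*} [Fintype m] [DecidableEq m]
    (L : Matrix m m ℂ) (l : Matrix (Fin 1) m ℂ) (d : ℝ) :
    (fromBlocks L 0 l ((d : ℂ) • (1 : Matrix (Fin 1) (Fin 1) ℂ))).det = L.det * d := by
  simp [det_fromBlocks_zero₁₂]

theorem fromBlocks_mul_mul_conjTranspose_toBlocks {m : Type*} [Fintype m] [DecidableEq m]
    (B : Matrix (m ⊕ Fin 1) (m ⊕ Fin 1) ℂ)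
    (L : Matrix m m ℂ) (l : Matrix (Fin 1) m ℂ) (D : Matrix (Fin 1) (Fin 1) ℂ) :
    (fromBlocks L 0 l D * B * (fromBlocks L 0 l D)ᴴ).toBlocks₁₁ =
        L * B.toBlocks₁₁ * Lᴴ ∧
      (fromBlocks L 0 l D * B * (fromBlocks L 0 l D)ᴴ).toBlocks₁₂ =
        L * (B.toBlocks₁₁ * lᴴ + B.toBlocks₁₂ * Dᴴ) := by
  obtain ⟨P, Q, R, S, rfl⟩ : ∃ P Q R S, B = fromBlocks P Q R S :=
    ⟨_, _, _, _, (fromBlocks_toBlocks B).symm⟩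
  simp [fromBlocks_multiply, fromBlocks_conjTranspose, Matrix.mul_add, Matrix.mul_assoc]

/-- A Hermitian bordered matrix is determined by its invertible principal block, its border
and its determinant. -/
theorem Matrix.IsHermitian.eq_of_toBlocks_eq_of_det_eq {m : Type*} [Fintype m] [DecidableEq m]
    {A M : Matrix (m ⊕ Fin 1) (m ⊕ Fin 1) ℂ} (hA : A.IsHermitian) (hM : M.IsHermitian)
    (h₁₁ : A.toBlocks₁₁ = M.toBlocks₁₁) (h₁₂ : A.toBlocks₁₂ = M.toBlocks₁₂)
    (h0 : A.toBlocks₁₁.det ≠ 0) (hdet : A.det = M.det) : A = M := by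
  have h₂₁ : A.toBlocks₂₁ = M.toBlocks₂₁ := by
    ext i j
    have h := congrFun (congrFun h₁₂ j) i
    simp only [toBlocks₁₂, toBlocks₂₁, of_apply] at h ⊢
    rw [← hA.apply, ← hM.apply, h]
  rw [← fromBlocks_toBlocks A, ← fromBlocks_toBlocks M, ← h₁₁, ← h₁₂, ← h₂₁] at hdet ⊢
  have := invertibleOfIsUnitDet A.toBlocks₁₁ (isUnit_iff_ne_zero.mpr h0)
  rw [det_fromBlocks₁₁, det_fromBlocks₁₁] at hdet
  have h := mul_left_cancel₀ h0 hdet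
  simp only [det_unique, Matrix.sub_apply, sub_left_inj] at h
  congr 1
  ext i j
  rw [Subsingleton.elim i default, Subsingleton.elim j default]
  exact h

theorem existsUnique_fromBlocks_mul_mul_conjTranspose {m : Type*} [Fintype m] [DecidableEq m]
    {A B : Matrix (m ⊕ Fin 1) (m ⊕ Fin 1) ℂ} (hA : A.IsHermitian) (hB : B.IsHermitian)
    {c : ℝ} (hc : 0 < c) (hdet : A.det = c * B.det) (hB0 : B.det ≠ 0)
    {L : Matrix m m ℂ} (h₁₁ : A.toBlocks₁₁ = L * B.toBlocks₁₁ * Lᴴ)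
    (h0 : A.toBlocks₁₁.det ≠ 0) :
    ∃! p : Matrix (Fin 1) m ℂ × ℝ, 0 < p.2 ∧
      A = fromBlocks L 0 p.1 ((p.2 : ℂ) • 1) * B * (fromBlocks L 0 p.1 ((p.2 : ℂ) • 1))ᴴ := by
  have hdets : L.det ≠ 0 ∧ B.toBlocks₁₁.det ≠ 0 := by
    rw [h₁₁, det_mul, det_mul] at h0
    exact ⟨left_ne_zero_of_mul (left_ne_zero_of_mul h0),
      right_ne_zero_of_mul (left_ne_zero_of_mul h0)⟩
  obtain ⟨hL0, hB₁₁⟩ := hdets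
  have hLu := isUnit_iff_ne_zero.mpr hL0
  have hBu := isUnit_iff_ne_zero.mpr hB₁₁
  have hnorm : 0 < Complex.normSq L.det := Complex.normSq_pos.mpr hL0
  have hconj (l : Matrix (Fin 1) m ℂ) (d : ℝ) :
      (fromBlocks L 0 l ((d : ℂ) • 1) * B * (fromBlocks L 0 l ((d : ℂ) • 1))ᴴ).det =
        ((Complex.normSq L.det * d ^ 2 : ℝ) : ℂ) * B.det := by
    rw [det_mul, det_mul, det_conjTranspose, det_fromBlocks_smul_one]
    push_cast
    rw [← Complex.mul_conj]
    simp only [Complex.star_def, map_mul, Complex.conj_ofReal]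
    ring
  refine ⟨((B.toBlocks₁₁⁻¹ * (L⁻¹ * A.toBlocks₁₂ -
      B.toBlocks₁₂ * ((Real.sqrt (c / Complex.normSq L.det) : ℂ) •
        (1 : Matrix (Fin 1) (Fin 1) ℂ))ᴴ))ᴴ,
      Real.sqrt (c / Complex.normSq L.det)), ⟨by positivity, ?_⟩, ?_⟩
  · refine IsHermitian.eq_of_toBlocks_eq_of_det_eq hA
      (isHermitian_mul_mul_conjTranspose _ hB) ?_ ?_ h0 ?_
    · rw [(fromBlocks_mul_mul_conjTranspose_toBlocks _ _ _ _).1, h₁₁]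
    · rw [(fromBlocks_mul_mul_conjTranspose_toBlocks _ _ _ _).2, conjTranspose_conjTranspose,
        mul_nonsing_inv_cancel_left _ _ hBu, sub_add_cancel, mul_nonsing_inv_cancel_left _ _ hLu]
    · rw [hconj, hdet, Real.sq_sqrt (by positivity), mul_div_cancel₀ _ hnorm.ne']
  · rintro ⟨l, d⟩ ⟨hd, h⟩
    dsimp only at hd h
    have hd' : d = Real.sqrt (c / Complex.normSq L.det) := by
      have h1 := hconj l d
      rw [← h, hdet] at h1
      have h2 : c = Complex.normSq L.det * d ^ 2 := by
        exact_mod_cast mul_right_cancel₀ hB0 h1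
      rw [h2, mul_div_cancel_left₀ _ hnorm.ne', Real.sqrt_sq hd.le]
    have h12 : A.toBlocks₁₂ = _ :=
      (congrArg toBlocks₁₂ h).trans (fromBlocks_mul_mul_conjTranspose_toBlocks _ _ _ _).2
    rw [Prod.mk.injEq]
    refine ⟨?_, hd'⟩
    rw [← hd', h12, nonsing_inv_mul_cancel_left _ _ hLu, add_sub_cancel_right,
      nonsing_inv_mul_cancel_left _ _ hBu, conjTranspose_conjTranspose]

theorem leadingMinorC_last {n : ℕ} (A : Matrix (Fin (n + 1)) (Fin (n + 1)) ℂ) :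
    leadingMinorC A (Fin.last n) = A.det := rfl

theorem memLPMC.submatrix_castSucc {n : ℕ} {ε : Fin (n + 1) → ℝ}
    {A : Matrix (Fin (n + 1)) (Fin (n + 1)) ℂ} (hA : memLPMC ε A) :
    memLPMC (fun k => ε k.castSucc) (A.submatrix Fin.castSucc Fin.castSucc) :=
  ⟨hA.1.submatrix _, fun k => hA.2 k.castSucc⟩

theorem memLPMC.det_ne_zero {n : ℕ} {ε : Fin n → ℝ} {A : Matrix (Fin n) (Fin n) ℂ}
    (hA : memLPMC ε A) : A.det ≠ 0 := by
  cases n with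
  | zero => simp
  | succ n =>
    intro h
    have h1 := (hA.2 (Fin.last n)).2
    simp [leadingMinorC_last, h] at h1

theorem memLPMC.exists_det_eq {n : ℕ} {ε : Fin n → ℝ} {A B : Matrix (Fin n) (Fin n) ℂ}
    (hA : memLPMC ε A) (hB : memLPMC ε B) : ∃ c : ℝ, 0 < c ∧ A.det = c * B.det := by
  cases n with
  | zero => exact ⟨1, one_pos, by simp⟩
  | succ n =>
    obtain ⟨hAi, hAr⟩ := hA.2 (Fin.last n)
    obtain ⟨hBi, hBr⟩ := hB.2 (Fin.last n)
    rw [leadingMinorC_last] at hAi hAr hBi hBr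
    have hB0 : B.det.re ≠ 0 := right_ne_zero_of_mul hBr.ne'
    refine ⟨A.det.re / B.det.re, ?_, ?_⟩
    · rw [← mul_div_mul_left _ _ (left_ne_zero_of_mul hBr.ne')]
      exact div_pos hAr hBr
    · apply Complex.ext
      · simp [hBi, hB0]
      · simp [hAi, hBi]

/-- The complex lower triangular matrices with strictly positive real diagonal entries. -/
def IsPosLower {n : ℕ} (L : Matrix (Fin n) (Fin n) ℂ) : Prop :=
  (∀ i j : Fin n, i < j → L i j = 0) ∧ ∀ j : Fin n, (L j j).im = 0 ∧ 0 < (L j j).re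

theorem IsPosLower.submatrix_castSucc {n : ℕ} {L : Matrix (Fin (n + 1)) (Fin (n + 1)) ℂ}
    (hL : IsPosLower L) : IsPosLower (L.submatrix Fin.castSucc Fin.castSucc) :=
  ⟨fun _ _ h => hL.1 _ _ (Fin.castSucc_lt_castSucc_iff.mpr h), fun j => hL.2 j.castSucc⟩

theorem IsPosLower.submatrix_finSumFinEquiv {n : ℕ} {L : Matrix (Fin (n + 1)) (Fin (n + 1)) ℂ}
    (hL : IsPosLower L) :
    L.submatrix finSumFinEquiv finSumFinEquiv =
      fromBlocks (L.submatrix Fin.castSucc Fin.castSucc) 0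
        (L.submatrix (fun _ => Fin.last n) Fin.castSucc)
        (((L (Fin.last n) (Fin.last n)).re : ℂ) • (1 : Matrix (Fin 1) (Fin 1) ℂ)) := by
  ext (i | i) (j | j)
  · rfl
  · rw [Subsingleton.elim j 0]
    exact hL.1 _ _ (Fin.castSucc_lt_last i)
  · rw [Subsingleton.elim i 0]
    rfl
  · rw [Subsingleton.elim i 0, Subsingleton.elim j 0]
    change L (Fin.last n) (Fin.last n) = _
    apply Complex.ext <;> simp [(hL.2 (Fin.last n)).1]

theorem isPosLower_fromBlocks {n : ℕ} {L : Matrix (Fin n) (Fin n) ℂ} (hL : IsPosLower L)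
    (l : Matrix (Fin 1) (Fin n) ℂ) {d : ℝ} (hd : 0 < d) :
    IsPosLower ((fromBlocks L 0 l ((d : ℂ) • (1 : Matrix (Fin 1) (Fin 1) ℂ))).submatrix
      (finSumFinEquiv (m := n) (n := 1)).symm finSumFinEquiv.symm) := by
  have hlast : (finSumFinEquiv (m := n) (n := 1)).symm (Fin.last n) = Sum.inr 0 :=
    finSumFinEquiv_symm_last
  have hcast (i : Fin n) : (finSumFinEquiv (m := n) (n := 1)).symm i.castSucc = Sum.inl i :=
    finSumFinEquiv_symm_apply_castAdd i
  refine ⟨fun i j => ?_, fun j => ?_⟩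
  · induction i using Fin.lastCases with
    | last => exact fun h => absurd h (Fin.le_last j).not_gt
    | cast i =>
      induction j using Fin.lastCases with
      | last => simp [hlast, hcast]
      | cast j => simpa [hcast] using hL.1 i j
  · induction j using Fin.lastCases with
    | last => simp [hlast, hd]
    | cast j => simpa [hcast] using hL.2 j

theorem memLPMC.existsUnique_isPosLower {n : ℕ} {ε : Fin n → ℝ}
    {A B : Matrix (Fin n) (Fin n) ℂ} (hA : memLPMC ε A) (hB : memLPMC ε B) :
    ∃! L : Matrix (Fin n) (Fin n) ℂ, IsPosLower L ∧ A = L * B * Lᴴ := by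
  induction n with
  | zero => exact ⟨0, ⟨⟨fun i => i.elim0, fun i => i.elim0⟩, Subsingleton.elim _ _⟩,
      fun _ _ => Subsingleton.elim _ _⟩
  | succ n ih =>
    obtain ⟨L, ⟨hL, hAL⟩, hLuniq⟩ := ih hA.submatrix_castSucc hB.submatrix_castSucc
    obtain ⟨c, hc, hdet⟩ := hA.exists_det_eq hB
    let e : Fin n ⊕ Fin 1 ≃ Fin (n + 1) := finSumFinEquiv
    have key (M : Matrix (Fin (n + 1)) (Fin (n + 1)) ℂ) : A = M * B * Mᴴ ↔
        A.submatrix e e = M.submatrix e e * B.submatrix e e * (M.submatrix e e)ᴴ := by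
      rw [conjTranspose_submatrix, submatrix_mul_equiv, submatrix_mul_equiv]
      exact (reindex e.symm e.symm).injective.eq_iff.symm
    obtain ⟨⟨l, d⟩, ⟨hd, hld⟩, huniq⟩ :=
      existsUnique_fromBlocks_mul_mul_conjTranspose (A := A.submatrix e e) (B := B.submatrix e e)
        (hA.1.submatrix e) (hB.1.submatrix e) hc (by simpa using hdet)
        (by simpa using hB.det_ne_zero) (L := L) hAL hA.submatrix_castSucc.det_ne_zero
    refine ⟨_, ⟨isPosLower_fromBlocks hL l hd, (key _).mpr ?_⟩, ?_⟩
    · simpa [e, submatrix_submatrix] using hld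
    · rintro M ⟨hM, hAM⟩
      rw [key] at hAM
      have hMb : M.submatrix e e = _ := hM.submatrix_finSumFinEquiv
      rw [hMb] at hAM
      have hML : M.submatrix Fin.castSucc Fin.castSucc = L := by
        refine hLuniq _ ⟨hM.submatrix_castSucc, ?_⟩
        exact (congrArg toBlocks₁₁ hAM).trans
          (fromBlocks_mul_mul_conjTranspose_toBlocks _ _ _ _).1
      rw [hML] at hAM hMb
      have h := huniq (M.submatrix (fun _ => Fin.last n) Fin.castSucc,
        (M (Fin.last n) (Fin.last n)).re) ⟨(hM.2 (Fin.last n)).2, hAM⟩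
      obtain ⟨h1, h2⟩ := Prod.ext_iff.mp h
      dsimp only at h1 h2 ⊢
      rw [h1, h2] at hMb
      rw [← hMb]
      simp [e, submatrix_submatrix]

/-- Fix a Hermitian `B ∈ LPM_n^ℂ(ε)`.  Every Hermitian
`A ∈ LPM_n^ℂ(ε)` admits a unique factorization `A = L * B * L*` where `L` is complex
lower triangular with strictly positive real diagonal entries. -/
theorem stmt8 (n : ℕ) (hn : 1 ≤ n) (ε : Fin n → ℝ)
    (hε : ∀ k, ε k = 1 ∨ ε k = -1)
    (B : Matrix (Fin n) (Fin n) ℂ) (hB : memLPMC ε B)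
    (A : Matrix (Fin n) (Fin n) ℂ) (hA : memLPMC ε A) :
    ∃! L : Matrix (Fin n) (Fin n) ℂ,
      ((∀ i j : Fin n, i < j → L i j = 0) ∧
        ∀ j : Fin n, (L j j).im = 0 ∧ 0 < (L j j).re) ∧
      A = L * B * Lᴴ := by
  exact hA.existsUnique_isPosLower hB
end

section
/- Let n ≥ 1, let ε ∈ {±1}ⁿ with ε₀ := 1, let D_ε := diag(ε₁, ε₁ε₂, …, ε_{n−1}ε_n), and let L be a real lower triangular n × n matrix with strictly positive diagonal entries. Then the real-linear map from the space of real lower triangular n × n matrices to the space of real symmetric n × n matrices given by X ↦ L·D_ε·Xᵀ + X·D_ε·Lᵀ is a linear isomorphism, with inverse given by W ↦ L·half(L⁻¹·W·L⁻ᵀ)·D_ε, where for a square matrix A, half(A) denotes its strictly lower triangular part plus one half of its diagonal part. -/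
open Matrix

/-- The diagonal matrix `D_ε = diag(ε₁, ε₁ε₂, …, ε_{n−1}ε_n)` (with `ε₀ := 1`). -/
def Dmat {n : ℕ} (ε : Fin n → ℝ) : Matrix (Fin n) (Fin n) ℝ :=
  Matrix.diagonal fun j =>
    (if j.val = 0 then 1 else ε ⟨j.val - 1, by have := j.isLt; omega⟩) * ε j

/-- Lower triangular predicate. -/
def IsLowerTri {n : ℕ} (L : Matrix (Fin n) (Fin n) ℝ) : Prop :=
  ∀ i j : Fin n, i < j → L i j = 0

/-- `half A = ⌊A⌋ + (1/2) 𝔻(A)`: the strictly lower triangular part of `A` plus one half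
of its diagonal part. -/
noncomputable def half {n : ℕ} (A : Matrix (Fin n) (Fin n) ℝ) : Matrix (Fin n) (Fin n) ℝ :=
  Matrix.of fun i j => if i = j then A i j / 2 else if j < i then A i j else 0

theorem isLowerTri_iff_blockTriangular {n : ℕ} {A : Matrix (Fin n) (Fin n) ℝ} :
    IsLowerTri A ↔ A.BlockTriangular OrderDual.toDual :=
  Iff.rfl

theorem IsLowerTri.mul {n : ℕ} {A B : Matrix (Fin n) (Fin n) ℝ} (hA : IsLowerTri A)
    (hB : IsLowerTri B) : IsLowerTri (A * B) :=
  isLowerTri_iff_blockTriangular.2 (BlockTriangular.mul hA hB)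

theorem isLowerTri_Dmat {n : ℕ} (ε : Fin n → ℝ) : IsLowerTri (Dmat ε) :=
  isLowerTri_iff_blockTriangular.2 (blockTriangular_diagonal _)

theorem isLowerTri_half {n : ℕ} (A : Matrix (Fin n) (Fin n) ℝ) : IsLowerTri (half A) := by
  intro i j hij
  simp [half, hij.ne, hij.not_gt]

theorem IsLowerTri.isUnit_det {n : ℕ} {L : Matrix (Fin n) (Fin n) ℝ} (hL : IsLowerTri L)
    (hLd : ∀ j, 0 < L j j) : IsUnit L.det := by
  rw [det_of_isLowerTriangular L hL]
  exact (Finset.prod_pos fun j _ => hLd j).ne'.isUnit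

theorem IsLowerTri.inv {n : ℕ} {L : Matrix (Fin n) (Fin n) ℝ} (hL : IsLowerTri L)
    (hdet : IsUnit L.det) : IsLowerTri L⁻¹ := by
  have := L.invertibleOfIsUnitDet hdet
  exact isLowerTri_iff_blockTriangular.2 (blockTriangular_inv_of_blockTriangular hL)

theorem Dmat_transpose {n : ℕ} (ε : Fin n → ℝ) : (Dmat ε)ᵀ = Dmat ε :=
  diagonal_transpose _

theorem Dmat_mul_self {n : ℕ} {ε : Fin n → ℝ} (hε : ∀ k, ε k = 1 ∨ ε k = -1) :
    Dmat ε * Dmat ε = 1 := by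
  have hsq (k : Fin n) : ε k * ε k = 1 := by
    rcases hε k with h | h <;> simp [h]
  rw [Dmat, diagonal_mul_diagonal, ← diagonal_one]
  congr 1
  funext j
  split_ifs
  · simp [hsq]
  · rw [mul_mul_mul_comm, hsq, hsq, one_mul]

theorem half_add_transpose_of_isLowerTri {n : ℕ} {A : Matrix (Fin n) (Fin n) ℝ}
    (hA : IsLowerTri A) : half (A + Aᵀ) = A := by
  ext i j
  rcases lt_trichotomy i j with h | rfl | h
  · simp [half, h.ne, h.not_gt, hA i j h]
  · simp [half]
  · simp [half, h.ne', h, hA j i h]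

theorem half_add_half_transpose {n : ℕ} {A : Matrix (Fin n) (Fin n) ℝ} (hA : A.IsSymm) :
    half A + (half A)ᵀ = A := by
  ext i j
  rcases lt_trichotomy i j with h | rfl | h
  · simp [half, h.ne, h.ne', h, h.not_gt, hA.apply i j]
  · simp [half]
  · simp [half, h.ne, h.ne', h, h.not_gt]

/-- For `L` lower triangular with positive diagonal, the linear map
`X ↦ L·D_ε·Xᵀ + X·D_ε·Lᵀ` is an isomorphism from lower triangular matrices onto
symmetric matrices, with inverse `W ↦ L·half(L⁻¹·W·L⁻ᵀ)·D_ε`. -/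
theorem stmt9 (n : ℕ) (hn : 1 ≤ n) (ε : Fin n → ℝ)
    (hε : ∀ k, ε k = 1 ∨ ε k = -1)
    (L : Matrix (Fin n) (Fin n) ℝ) (hL : IsLowerTri L) (hLd : ∀ j, 0 < L j j) :
    (∀ X : Matrix (Fin n) (Fin n) ℝ, IsLowerTri X →
      (L * Dmat ε * Xᵀ + X * Dmat ε * Lᵀ).IsSymm) ∧
    (∀ X : Matrix (Fin n) (Fin n) ℝ, IsLowerTri X →
      L * half (L⁻¹ * (L * Dmat ε * Xᵀ + X * Dmat ε * Lᵀ) * (L⁻¹)ᵀ) * Dmat ε = X) ∧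
    (∀ W : Matrix (Fin n) (Fin n) ℝ, W.IsSymm →
      IsLowerTri (L * half (L⁻¹ * W * (L⁻¹)ᵀ) * Dmat ε)) ∧
    (∀ W : Matrix (Fin n) (Fin n) ℝ, W.IsSymm →
      L * Dmat ε * (L * half (L⁻¹ * W * (L⁻¹)ᵀ) * Dmat ε)ᵀ +
        (L * half (L⁻¹ * W * (L⁻¹)ᵀ) * Dmat ε) * Dmat ε * Lᵀ = W) := by
  have hdet := hL.isUnit_det hLd
  have hDD := Dmat_mul_self hε
  have hDT := Dmat_transpose ε
  have hLL := L.mul_nonsing_inv hdet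
  have hLL' := L.nonsing_inv_mul hdet
  have hTT : Lᵀ * (L⁻¹)ᵀ = 1 := by rw [← transpose_mul, hLL', transpose_one]
  have hTT' : (L⁻¹)ᵀ * Lᵀ = 1 := by rw [← transpose_mul, hLL, transpose_one]
  refine ⟨fun X _ => ?_, fun X hX => ?_, fun W _ => ?_, fun W hW => ?_⟩
  · simp only [IsSymm, transpose_add, transpose_mul, transpose_transpose, hDT,
      Matrix.mul_assoc]
    exact add_comm _ _
  · have hA : IsLowerTri (L⁻¹ * X * Dmat ε) :=
      ((hL.inv hdet).mul hX).mul (isLowerTri_Dmat ε)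
    have key : L⁻¹ * (L * Dmat ε * Xᵀ + X * Dmat ε * Lᵀ) * (L⁻¹)ᵀ =
        L⁻¹ * X * Dmat ε + (L⁻¹ * X * Dmat ε)ᵀ := by
      calc _ = (L⁻¹ * L) * Dmat ε * Xᵀ * (L⁻¹)ᵀ + L⁻¹ * X * Dmat ε * (Lᵀ * (L⁻¹)ᵀ) := by
            noncomm_ring
        _ = _ := by
            rw [hLL', hTT, add_comm]
            simp only [transpose_mul, hDT, Matrix.mul_assoc, Matrix.mul_one, Matrix.one_mul]
    rw [key, half_add_transpose_of_isLowerTri hA]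
    calc _ = (L * L⁻¹) * X * (Dmat ε * Dmat ε) := by simp only [Matrix.mul_assoc]
      _ = X := by rw [hLL, hDD, Matrix.one_mul, Matrix.mul_one]
  · exact (hL.mul (isLowerTri_half _)).mul (isLowerTri_Dmat ε)
  · have hS : (L⁻¹ * W * (L⁻¹)ᵀ).IsSymm := by
      simp only [IsSymm, transpose_mul, transpose_transpose, hW.eq, Matrix.mul_assoc]
    have hsum := half_add_half_transpose hS
    set H := half (L⁻¹ * W * (L⁻¹)ᵀ)
    calc _ = L * (Dmat ε * Dmat ε) * Hᵀ * Lᵀ + L * H * (Dmat ε * Dmat ε) * Lᵀ := by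
          simp only [transpose_mul, hDT, Matrix.mul_assoc]
      _ = L * (H + Hᵀ) * Lᵀ := by
          rw [hDD]
          noncomm_ring
      _ = (L * L⁻¹) * W * ((L⁻¹)ᵀ * Lᵀ) := by
          rw [hsum]
          simp only [Matrix.mul_assoc]
      _ = W := by rw [hLL, hTT', Matrix.one_mul, Matrix.mul_one]
end

section
/- Let n ≥ 1 and let L_n be the set of real lower triangular n × n matrices with strictly positive diagonal entries. Define L ⊙ K := ⌊L⌋ + ⌊K⌋ + 𝔻(L)·𝔻(K). Then (L_n, ⊙) is an abelian group: ⊙ is a commutative and associative binary operation on L_n, the identity matrix Id_n is its identity element, and each L ∈ L_n has inverse −⌊L⌋ + 𝔻(L)⁻¹ ∈ L_n. -/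
open Matrix

/-- The strictly lower triangular part `⌊A⌋`. -/
def strictLower {n : ℕ} (A : Matrix (Fin n) (Fin n) ℝ) : Matrix (Fin n) (Fin n) ℝ :=
  Matrix.of fun i j => if j < i then A i j else 0

/-- The diagonal part `𝔻(A)`. -/
def diagPart {n : ℕ} (A : Matrix (Fin n) (Fin n) ℝ) : Matrix (Fin n) (Fin n) ℝ :=
  Matrix.diagonal fun i => A i i

/-- The group operation `L ⊙ K := ⌊L⌋ + ⌊K⌋ + 𝔻(L)·𝔻(K)` on Cholesky space. -/
def cholOp {n : ℕ} (L K : Matrix (Fin n) (Fin n) ℝ) : Matrix (Fin n) (Fin n) ℝ :=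
  strictLower L + strictLower K + diagPart L * diagPart K

theorem cholOp_apply {n : ℕ} (L K : Matrix (Fin n) (Fin n) ℝ) (i j : Fin n) :
    cholOp L K i j =
      if j < i then L i j + K i j else if i = j then L i i * K i i else 0 := by
  rcases lt_trichotomy i j with h | rfl | h
  · simp [cholOp, strictLower, diagPart, h.not_gt, h.ne]
  · simp [cholOp, strictLower, diagPart]
  · simp [cholOp, strictLower, diagPart, h, h.ne']

theorem diagPart_inv {n : ℕ} {L : Matrix (Fin n) (Fin n) ℝ} (hL : ∀ j, L j j ≠ 0) :
    (diagPart L)⁻¹ = Matrix.diagonal fun i => (L i i)⁻¹ := by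
  apply Matrix.inv_eq_right_inv
  simp [diagPart, hL]

theorem cholInv_apply {n : ℕ} {L : Matrix (Fin n) (Fin n) ℝ} (hL : ∀ j, L j j ≠ 0)
    (i j : Fin n) :
    (-strictLower L + (diagPart L)⁻¹) i j =
      if j < i then -L i j else if i = j then (L i i)⁻¹ else 0 := by
  rw [diagPart_inv hL]
  rcases lt_trichotomy i j with h | rfl | h
  · simp [strictLower, h.not_gt, h.ne]
  · simp [strictLower]
  · simp [strictLower, h, h.ne']

/-- `(L_n, ⊙)` is an abelian group: `⊙` is a commutative, associative
operation on `L_n`, with identity `Id_n` and inverse `L ↦ −⌊L⌋ + 𝔻(L)⁻¹`. -/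
theorem stmt10 (n : ℕ) (hn : 1 ≤ n) :
    (∀ L K : Matrix (Fin n) (Fin n) ℝ, InCholSpace L → InCholSpace K →
      InCholSpace (cholOp L K)) ∧
    (∀ L K : Matrix (Fin n) (Fin n) ℝ, InCholSpace L → InCholSpace K →
      cholOp L K = cholOp K L) ∧
    (∀ L K M : Matrix (Fin n) (Fin n) ℝ,
      InCholSpace L → InCholSpace K → InCholSpace M →
      cholOp (cholOp L K) M = cholOp L (cholOp K M)) ∧
    InCholSpace (1 : Matrix (Fin n) (Fin n) ℝ) ∧
    (∀ L : Matrix (Fin n) (Fin n) ℝ, InCholSpace L →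
      cholOp L (1 : Matrix (Fin n) (Fin n) ℝ) = L) ∧
    (∀ L : Matrix (Fin n) (Fin n) ℝ, InCholSpace L →
      InCholSpace (-strictLower L + (diagPart L)⁻¹) ∧
      cholOp L (-strictLower L + (diagPart L)⁻¹) = 1) := by
  refine ⟨fun L K hL hK => ⟨fun i j h => ?_, fun j => ?_⟩, fun L K _ _ => ?_,
    fun L K M _ _ _ => ?_, ⟨fun i j h => Matrix.one_apply_ne h.ne, fun j => by simp⟩,
    fun L hL => ?_, fun L hL => ?_⟩
  · simp [cholOp_apply, h.not_gt, h.ne]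
  · simpa [cholOp_apply] using mul_pos (hL.2 j) (hK.2 j)
  · ext i j
    simp only [cholOp_apply, add_comm, mul_comm]
  · ext i j
    rcases lt_trichotomy i j with h | rfl | h
    · simp [cholOp_apply, h.not_gt, h.ne]
    · simp [cholOp_apply, mul_assoc]
    · simp [cholOp_apply, h, add_assoc]
  · ext i j
    rcases lt_trichotomy i j with h | rfl | h
    · simp [cholOp_apply, h.not_gt, h.ne, hL.1 i j h]
    · simp [cholOp_apply]
    · simp [cholOp_apply, h, h.ne']
  · have h0 : ∀ j, L j j ≠ 0 := fun j => (hL.2 j).ne'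
    refine ⟨⟨fun i j h => ?_, fun j => ?_⟩, ?_⟩
    · rw [cholInv_apply h0, if_neg h.not_gt, if_neg h.ne]
    · simpa only [cholInv_apply h0, lt_irrefl, if_false, if_true] using inv_pos.2 (hL.2 j)
    · ext i j
      rw [cholOp_apply, cholInv_apply h0, cholInv_apply h0]
      rcases lt_trichotomy i j with h | rfl | h
      · simp [h.not_gt, h.ne]
      · simp [h0]
      · simp [h, h.ne']
end

section
/- Let n ≥ 1, let ε ∈ {±1}ⁿ with ε₀ := 1, let D_ε := diag(ε₁, ε₁ε₂, …, ε_{n−1}ε_n), and let L = (l_{ij}) be a real lower triangular n × n matrix with strictly positive diagonal entries. Let T be the real-linear endomorphism of the space of real lower triangular n × n matrices given by T(X) := lowerPart(L·D_ε·Xᵀ + X·D_ε·Lᵀ), where lowerPart(W) is the matrix with entries W_{ij} for i ≥ j and 0 for i < j. Then det(T) = 2ⁿ · ∏_{j=1}^n (ε_{j−1}·ε_j·l_{jj})^{n+1−j}. -/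
open Matrix

/-- `lowerPart W`: the matrix with entries `W i j` for `i ≥ j` and `0` for `i < j`. -/
def lowerPart {n : ℕ} (W : Matrix (Fin n) (Fin n) ℝ) : Matrix (Fin n) (Fin n) ℝ :=
  Matrix.of fun i j => if j ≤ i then W i j else 0

/-- The space of real lower triangular `n × n` matrices, as a submodule. -/
def lowerTriMod (n : ℕ) : Submodule ℝ (Matrix (Fin n) (Fin n) ℝ) where
  carrier := {X | ∀ i j : Fin n, i < j → X i j = 0}
  add_mem' := fun ha hb i j hij => by
    simp [Matrix.add_apply, ha i j hij, hb i j hij]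
  zero_mem' := fun i j _ => rfl
  smul_mem' := fun c X hX i j hij => by
    simp [Matrix.smul_apply, hX i j hij]

theorem lowerPart_mem {n : ℕ} (W : Matrix (Fin n) (Fin n) ℝ) :
    lowerPart W ∈ lowerTriMod n := by
  intro i j hij
  simp [lowerPart, Matrix.of_apply, not_le.mpr hij]

/-- `lowerPart` as a linear map. -/
def lowerPartLin (n : ℕ) :
    Matrix (Fin n) (Fin n) ℝ →ₗ[ℝ] Matrix (Fin n) (Fin n) ℝ where
  toFun := lowerPart
  map_add' X Y := by
    ext i j
    by_cases h : j ≤ i <;> simp [lowerPart, Matrix.of_apply, Matrix.add_apply, h]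
  map_smul' c X := by
    ext i j
    by_cases h : j ≤ i <;> simp [lowerPart, Matrix.of_apply, Matrix.smul_apply, h]

/-- `X ↦ L·D·Xᵀ + X·D·Lᵀ` as a linear map on matrices. -/
def Smap {n : ℕ} (D L : Matrix (Fin n) (Fin n) ℝ) :
    Matrix (Fin n) (Fin n) ℝ →ₗ[ℝ] Matrix (Fin n) (Fin n) ℝ where
  toFun X := L * D * Xᵀ + X * D * Lᵀ
  map_add' X Y := by
    simp only [Matrix.transpose_add, Matrix.mul_add, Matrix.add_mul]
    abel
  map_smul' c X := by
    simp only [Matrix.transpose_smul, Matrix.mul_smul, Matrix.smul_mul,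
      RingHom.id_apply, smul_add]

/-- The endomorphism `T(X) = lowerPart (L·D_ε·Xᵀ + X·D_ε·Lᵀ)` of the space of real
lower triangular matrices. -/
noncomputable def Tmap {n : ℕ} (ε : Fin n → ℝ) (L : Matrix (Fin n) (Fin n) ℝ) :
    lowerTriMod n →ₗ[ℝ] lowerTriMod n :=
  ((lowerPartLin n).comp (Smap (Dmat ε) L)).restrict fun X _ => lowerPart_mem _

/-- Positions `(column, row)` on or below the diagonal, in column-major order. -/
abbrev LowerIdx (n : ℕ) := {p : Fin n ×ₗ Fin n // (ofLex p).1 ≤ (ofLex p).2}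

/-- A lower triangular matrix is determined by its entries on or below the diagonal. -/
def lowerTriEquivFun (n : ℕ) : lowerTriMod n ≃ₗ[ℝ] (LowerIdx n → ℝ) where
  toFun X p := X.1 (ofLex p.1).2 (ofLex p.1).1
  invFun f := ⟨Matrix.of fun i j => if h : j ≤ i then f ⟨toLex (j, i), h⟩ else 0,
    fun i j hij => by simp [not_le.mpr hij]⟩
  map_add' _ _ := rfl
  map_smul' _ _ := rfl
  left_inv X := by
    ext i j
    by_cases h : j ≤ i
    · simp [h]
    · simp [h, X.2 i j (not_le.mp h)]
  right_inv f := by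
    ext ⟨p, hp⟩
    simp [hp]

/-- The basis of elementary lower triangular matrices. -/
noncomputable def lowerTriBasis (n : ℕ) : Module.Basis (LowerIdx n) ℝ (lowerTriMod n) :=
  Module.Basis.ofEquivFun (lowerTriEquivFun n)

theorem lowerTriBasis_repr_apply {n : ℕ} (X : lowerTriMod n) (p : LowerIdx n) :
    (lowerTriBasis n).repr X p = X.1 (ofLex p.1).2 (ofLex p.1).1 := rfl

theorem lowerTriBasis_apply {n : ℕ} (q : LowerIdx n) (i j : Fin n) :
    (lowerTriBasis n q).1 i j = if (ofLex q.1).2 = i ∧ (ofLex q.1).1 = j then 1 else 0 := by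
  by_cases h : j ≤ i
  · have := lowerTriBasis_repr_apply (lowerTriBasis n q) ⟨toLex (j, i), h⟩
    rw [Module.Basis.repr_self, Finsupp.single_apply] at this
    refine this.symm.trans ?_
    refine if_congr ?_ rfl rfl
    rw [Subtype.ext_iff, ← ofLex_inj, ofLex_toLex, Prod.ext_iff]
    exact and_comm
  · rw [(lowerTriBasis n _).2 i j (not_le.mp h), if_neg]
    rintro ⟨rfl, rfl⟩
    exact h q.2

/-- The endomorphism `X ↦ lowerPart (L·D·Xᵀ + X·D·Lᵀ)` for an arbitrary matrix `D`. -/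
noncomputable def lowerSmap {n : ℕ} (D L : Matrix (Fin n) (Fin n) ℝ) :
    lowerTriMod n →ₗ[ℝ] lowerTriMod n :=
  ((lowerPartLin n).comp (Smap D L)).restrict fun _ _ => lowerPart_mem _

theorem lowerSmap_diagonal_toMatrix_apply {n : ℕ} (d : Fin n → ℝ)
    (L : Matrix (Fin n) (Fin n) ℝ) (p q : LowerIdx n) :
    LinearMap.toMatrix (lowerTriBasis n) (lowerTriBasis n) (lowerSmap (diagonal d) L) p q =
      (if (ofLex q.1).2 = (ofLex p.1).1 then
        L (ofLex p.1).2 (ofLex q.1).1 * d (ofLex q.1).1 else 0) +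
      (if (ofLex q.1).2 = (ofLex p.1).2 then
        d (ofLex q.1).1 * L (ofLex p.1).1 (ofLex q.1).1 else 0) := by
  rw [LinearMap.toMatrix_apply, lowerTriBasis_repr_apply]
  change (if (ofLex p.1).1 ≤ (ofLex p.1).2 then
    (L * diagonal d * (lowerTriBasis n q).1ᵀ + (lowerTriBasis n q).1 * diagonal d * Lᵀ)
      (ofLex p.1).2 (ofLex p.1).1 else 0) = _
  rw [if_pos p.2, Matrix.add_apply, Matrix.mul_apply, Matrix.mul_apply]
  simp only [Matrix.mul_diagonal, Matrix.transpose_apply, lowerTriBasis_apply, ite_and]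
  congr 1 <;> split_ifs <;> simp

theorem lowerSmap_diagonal_toMatrix_self {n : ℕ} (d : Fin n → ℝ)
    (L : Matrix (Fin n) (Fin n) ℝ) (p : LowerIdx n) :
    LinearMap.toMatrix (lowerTriBasis n) (lowerTriBasis n) (lowerSmap (diagonal d) L) p p =
      (if (ofLex p.1).2 = (ofLex p.1).1 then 2 else 1) *
        (d (ofLex p.1).1 * L (ofLex p.1).1 (ofLex p.1).1) := by
  rw [lowerSmap_diagonal_toMatrix_apply, if_pos (rfl : (ofLex p.1).2 = (ofLex p.1).2)]
  split_ifs with h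
  · rw [h]; ring
  · simp

theorem lowerSmap_diagonal_toMatrix_of_lt {n : ℕ} (d : Fin n → ℝ)
    {L : Matrix (Fin n) (Fin n) ℝ} (hL : IsLowerTri L) {p q : LowerIdx n} (hpq : p < q) :
    LinearMap.toMatrix (lowerTriBasis n) (lowerTriBasis n) (lowerSmap (diagonal d) L) p q = 0 := by
  rw [lowerSmap_diagonal_toMatrix_apply]
  obtain ⟨p, hp⟩ := p
  obtain ⟨q, hq⟩ := q
  rw [Subtype.mk_lt_mk, Prod.Lex.lt_iff] at hpq
  dsimp only
  rw [if_neg, zero_add]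
  · split_ifs with h
    · rcases hpq with hlt | ⟨-, hlt⟩
      · rw [hL _ _ hlt, mul_zero]
      · exact absurd hlt (h ▸ lt_irrefl _)
    · rfl
  · intro h
    rcases hpq with hlt | ⟨he, hlt⟩
    · exact absurd (hq.trans h.le) (not_le.mpr hlt)
    · exact absurd (hp.trans_lt hlt) (h ▸ lt_irrefl _)

theorem det_lowerSmap_diagonal {n : ℕ} (d : Fin n → ℝ)
    {L : Matrix (Fin n) (Fin n) ℝ} (hL : IsLowerTri L) :
    LinearMap.det (lowerSmap (diagonal d) L) =
      2 ^ n * ∏ j : Fin n, (d j * L j j) ^ (n - j.val) := by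
  rw [← LinearMap.det_toMatrix (lowerTriBasis n), Matrix.det_of_isLowerTriangular]
  · simp only [lowerSmap_diagonal_toMatrix_self]
    let f : Fin n × Fin n → ℝ := fun p =>
      (if p.2 = p.1 then 2 else 1) * (d p.1 * L p.1 p.1)
    calc ∏ p : LowerIdx n, f (ofLex p.1)
        = ∏ p : Fin n × Fin n with p.1 ≤ p.2, f p :=
          (Finset.prod_subtype (p := fun p : Fin n × Fin n => p.1 ≤ p.2) _ (by simp) f).symm
      _ = ∏ j : Fin n, ∏ i : Fin n, if j ≤ i then f (j, i) else 1 := by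
          rw [Finset.prod_filter, Fintype.prod_prod_type]
      _ = ∏ j : Fin n, 2 * (d j * L j j) ^ (n - j.val) := by
          refine Finset.prod_congr rfl fun j _ => ?_
          rw [← Finset.prod_filter, Finset.filter_le_eq_Ici, Finset.prod_mul_distrib,
            Finset.prod_ite_eq', if_pos (Finset.mem_Ici.mpr le_rfl)]
          dsimp only
          rw [Finset.prod_const, Fin.card_Ici]
      _ = _ := by
          rw [Finset.prod_mul_distrib, Finset.prod_const, Finset.card_univ, Fintype.card_fin]
  · exact fun p q hpq => lowerSmap_diagonal_toMatrix_of_lt d hL hpq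

/-- For `L ∈ L_n` the determinant of `T` equals
`2ⁿ · ∏_{j=1}^n (ε_{j−1} ε_j l_{jj})^{n+1−j}`. -/
theorem stmt13 (n : ℕ) (hn : 1 ≤ n) (ε : Fin n → ℝ)
    (hε : ∀ k, ε k = 1 ∨ ε k = -1)
    (L : Matrix (Fin n) (Fin n) ℝ) (hL : IsLowerTri L) (hLd : ∀ j, 0 < L j j) :
    LinearMap.det (Tmap ε L) =
      2 ^ n * ∏ j : Fin n,
        ((if j.val = 0 then 1 else ε ⟨j.val - 1, by have := j.isLt; omega⟩) * ε j
            * L j j) ^ (n - j.val) := by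
  exact det_lowerSmap_diagonal _ hL
end

section
/- Let n, n' ≥ 1 and let ε ∈ {±1}ⁿ, ε' ∈ {±1}^{n'} be sign patterns, with conventions ε₀ := 1, ε'₀ := 1. Let A ∈ LPM_n(ε) and A' ∈ LPM_{n'}(ε') be real symmetric matrices, and let D_ε := diag(ε₁, ε₁ε₂, …, ε_{n−1}ε_n) and D_{ε'} := diag(ε'₁, ε'₁ε'₂, …, ε'_{n'−1}ε'_{n'}). Then for every 1 ≤ k ≤ n·n', the leading principal k × k minor of the Kronecker product A ⊗ A' is nonzero with sign equal to the product of the first k diagonal entries of D_ε ⊗ D_{ε'}; in particular A ⊗ A' ∈ LPM_{nn'}(ε ⊗ ε'), where ε ⊗ ε' is the sign pattern determined by D_{ε⊗ε'} = D_ε ⊗ D_{ε'}. -/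
open Matrix

theorem Fin.sum_eq_sum_castLE {M : Type*} [AddCommMonoid M] {m n : ℕ} (h : m ≤ n) (f : Fin n → M)
    (hf : ∀ x : Fin n, m ≤ x.val → f x = 0) : ∑ x, f x = ∑ i : Fin m, f (Fin.castLE h i) := by
  symm
  refine Fintype.sum_of_injective (Fin.castLE h) (Fin.castLE_injective h) _ _ ?_ fun _ => rfl
  intro x hx
  refine hf x ?_
  by_contra! hlt
  exact hx ⟨⟨x, hlt⟩, rfl⟩

theorem leadingMinor_diagonal {n : ℕ} (d : Fin n → ℝ) (k : Fin n) :
    leadingMinor (diagonal d) k = ∏ j : Fin (k.val + 1), d (Fin.castLE k.isLt j) := by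
  rw [leadingMinor, submatrix_diagonal _ _ (Fin.castLE_injective _), det_diagonal]
  rfl

/-- Congruence by an upper unitriangular matrix preserves the leading principal minors. -/
theorem leadingMinor_transpose_mul_mul {n : ℕ} (A U : Matrix (Fin n) (Fin n) ℝ)
    (hU : U.IsUpperTriangular) (hU1 : ∀ i, U i i = 1) (k : Fin n) :
    leadingMinor (Uᵀ * A * U) k = leadingMinor A k := by
  set e : Fin (k.val + 1) → Fin n := Fin.castLE k.isLt with he
  have hzero : ∀ (x : Fin n) (j : Fin (k.val + 1)), k.val + 1 ≤ x.val → U x (e j) = 0 := by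
    intro x j hx
    refine hU (show e j < x from ?_)
    have := j.isLt
    simp only [he, Fin.lt_def, Fin.val_castLE]
    omega
  have hsub : (Uᵀ * A * U).submatrix e e
      = (U.submatrix e e)ᵀ * A.submatrix e e * U.submatrix e e := by
    ext i j
    simp only [submatrix_apply, mul_apply, transpose_apply]
    rw [Fin.sum_eq_sum_castLE (Nat.succ_le_of_lt k.isLt)]
    · refine Finset.sum_congr rfl fun x _ => ?_
      rw [Fin.sum_eq_sum_castLE (Nat.succ_le_of_lt k.isLt)]
      intro y hy
      rw [hzero y i hy, zero_mul]
    · intro x hx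
      rw [hzero x j hx, mul_zero]
  have hdet : (U.submatrix e e).det = 1 := by
    rw [det_of_isUpperTriangular]
    · simp [hU1]
    · intro i j hij
      exact hU (show e j < e i from hij)
  rw [leadingMinor, leadingMinor, ← he, hsub, det_mul, det_mul, det_transpose, hdet]
  ring

theorem det_submatrix_castLE_ne_zero {n : ℕ} {A : Matrix (Fin n) (Fin n) ℝ}
    (hA : ∀ k, leadingMinor A k ≠ 0) {m : ℕ} (hm : m ≤ n) :
    (A.submatrix (Fin.castLE hm) (Fin.castLE hm)).det ≠ 0 := by
  cases m with
  | zero => simp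
  | succ m => exact hA ⟨m, hm⟩

theorem exists_column_orthogonal {n : ℕ} {A : Matrix (Fin n) (Fin n) ℝ}
    (hA : ∀ k, leadingMinor A k ≠ 0) (j : Fin n) :
    ∃ u : Fin n → ℝ, u j = 1 ∧ (∀ i, j < i → u i = 0) ∧ ∀ i, i < j → (A *ᵥ u) i = 0 := by
  set B := A.submatrix (Fin.castLE j.isLt.le) (Fin.castLE j.isLt.le) with hB
  have hBdet : IsUnit B.det := (det_submatrix_castLE_ne_zero hA j.isLt.le).isUnit
  set b : Fin j.val → ℝ := fun i => A (Fin.castLE j.isLt.le i) j with hb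
  set v := -(B⁻¹ *ᵥ b) with hv
  have hBv : B *ᵥ v = -b := by
    rw [hv, mulVec_neg, mulVec_mulVec, mul_nonsing_inv _ hBdet, one_mulVec]
  refine ⟨fun i => if h : i < j then v ⟨i, h⟩ else if i = j then 1 else 0, by simp, ?_, ?_⟩
  · intro i hi
    simp [hi.not_gt, hi.ne']
  · intro i hi
    have hrow := congrFun hBv ⟨i, hi⟩
    simp only [mulVec, dotProduct, Pi.neg_apply, hB, hb, submatrix_apply] at hrow
    simp only [mulVec, dotProduct]
    rw [Fin.sum_eq_sum_castLE (Nat.succ_le_of_lt j.isLt), Fin.sum_univ_castSucc]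
    · have hlast : Fin.castLE (Nat.succ_le_of_lt j.isLt) (Fin.last j.val) = j := rfl
      have hlt : ∀ x : Fin j.val, Fin.castLE (Nat.succ_le_of_lt j.isLt) x.castSucc < j :=
        fun x => x.isLt
      simp only [hlast, hlt, dif_pos, lt_irrefl, dif_neg, not_false_eq_true, if_true, mul_one]
      exact (eq_neg_iff_add_eq_zero).1 hrow
    · intro x hx
      have hjx : j < x := hx
      simp [hjx.not_gt, hjx.ne']

/-- A symmetric matrix with nonzero leading principal minors is diagonalized by congruence with an
upper unitriangular matrix. -/
theorem exists_unitriangular_congr_diagonal {n : ℕ} {A : Matrix (Fin n) (Fin n) ℝ}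
    (hsymm : A.IsSymm) (hA : ∀ k, leadingMinor A k ≠ 0) :
    ∃ (U : Matrix (Fin n) (Fin n) ℝ) (d : Fin n → ℝ),
      U.IsUpperTriangular ∧ (∀ i, U i i = 1) ∧ Uᵀ * A * U = diagonal d := by
  choose u hu1 hu0 hAu using exists_column_orthogonal hA
  set U : Matrix (Fin n) (Fin n) ℝ := of fun i j => u j i with hU
  have hlower : ∀ i j, i < j → (Uᵀ * A * U) i j = 0 := by
    intro i j hij
    rw [Matrix.mul_assoc, mul_apply]
    refine Finset.sum_eq_zero fun x _ => ?_
    rcases lt_or_ge i x with hx | hx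
    · rw [transpose_apply, hU, of_apply, hu0 i x hx, zero_mul]
    · have : (A * U) x j = 0 := hAu j x (hx.trans_lt hij)
      rw [this, mul_zero]
  have hS : (Uᵀ * A * U).IsSymm := by
    rw [IsSymm, transpose_mul, transpose_mul, transpose_transpose, hsymm.eq, Matrix.mul_assoc]
  refine ⟨U, (Uᵀ * A * U).diag, fun i j hij => hu0 j i hij, hu1, ?_⟩
  ext i j
  rcases lt_trichotomy i j with h | rfl | h
  · rw [hlower i j h, diagonal_apply_ne _ h.ne]
  · simp
  · rw [← hS.apply, hlower j i h, diagonal_apply_ne _ h.ne']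

theorem Dmat_mul_pos {n : ℕ} {ε d : Fin n → ℝ}
    (h : ∀ k, 0 < ε k * leadingMinor (diagonal d) k) (j : Fin n) : 0 < Dmat ε j j * d j := by
  simp only [leadingMinor_diagonal] at h
  rw [Dmat, diagonal_apply_eq]
  obtain ⟨j, hj⟩ := j
  cases j with
  | zero =>
    have h₀ := h ⟨0, hj⟩
    rw [Fin.prod_univ_one] at h₀
    rw [if_pos rfl, one_mul]
    exact h₀
  | succ j =>
    have h₀ := h ⟨j, by omega⟩
    have h₁ := h ⟨j + 1, hj⟩
    rw [Fin.prod_univ_castSucc] at h₁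
    set P := ∏ i : Fin (j + 1), d (Fin.castLE (show j + 1 ≤ n by omega) i)
    change 0 < ε ⟨j, _⟩ * P at h₀
    change 0 < ε ⟨j + 1, _⟩ * (P * d ⟨j + 1, hj⟩) at h₁
    simp only [Nat.add_eq_zero_iff, one_ne_zero, and_false, if_false, Nat.add_sub_cancel]
    have hP2 : 0 < P ^ 2 := by
      have : P ≠ 0 := right_ne_zero_of_mul h₀.ne'
      positivity
    refine pos_of_mul_pos_left (b := P ^ 2) ?_ hP2.le
    nlinarith [mul_pos h₀ h₁]

theorem memLPM.exists_diagonal {n : ℕ} {ε : Fin n → ℝ} {A : Matrix (Fin n) (Fin n) ℝ}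
    (hA : memLPM ε A) :
    ∃ (U : Matrix (Fin n) (Fin n) ℝ) (d : Fin n → ℝ), U.IsUpperTriangular ∧ (∀ i, U i i = 1) ∧
      Uᵀ * A * U = diagonal d ∧ ∀ j, 0 < Dmat ε j j * d j := by
  obtain ⟨U, d, hU, hU1, hd⟩ :=
    exists_unitriangular_congr_diagonal hA.1 fun k => right_ne_zero_of_mul (hA.2 k).ne'
  refine ⟨U, d, hU, hU1, hd, Dmat_mul_pos fun k => ?_⟩
  rw [← hd, leadingMinor_transpose_mul_mul A U hU hU1]
  exact hA.2 k

theorem isUpperTriangular_kronecker_finProdFinEquiv {m n : ℕ} {U : Matrix (Fin m) (Fin m) ℝ}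
    {V : Matrix (Fin n) (Fin n) ℝ} (hU : U.IsUpperTriangular) (hV : V.IsUpperTriangular) :
    ((kroneckerMap (· * ·) U V).submatrix
      finProdFinEquiv.symm finProdFinEquiv.symm).IsUpperTriangular := by
  intro p q hpq
  obtain ⟨⟨i, i'⟩, rfl⟩ := finProdFinEquiv.surjective p
  obtain ⟨⟨j, j'⟩, rfl⟩ := finProdFinEquiv.surjective q
  simp only [submatrix_apply, Equiv.symm_apply_apply, kroneckerMap_apply]
  have hlt : j'.val + n * j.val < i'.val + n * i.val := hpq
  rcases lt_trichotomy j i with h | rfl | h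
  · rw [hU (show j < i from h), zero_mul]
  · rw [hV (show j' < i' from by rw [Fin.lt_def]; omega), mul_zero]
  · have hmul : n * (i.val + 1) ≤ n * j.val := Nat.mul_le_mul_left n h
    have := i'.isLt
    rw [mul_add, mul_one] at hmul
    omega

/-- If `A ∈ LPM_n(ε)` and `A' ∈ LPM_{n'}(ε')`, then the Kronecker
product `A ⊗ A'` (with rows and columns in lexicographic order) lies in
`LPM_{nn'}(ε ⊗ ε')`: its leading principal `k × k` minor is nonzero with sign equal to
the product of the first `k` diagonal entries of `D_ε ⊗ D_{ε'}`. -/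
theorem stmt18 (n n' : ℕ) (hn : 1 ≤ n) (hn' : 1 ≤ n')
    (ε : Fin n → ℝ) (ε' : Fin n' → ℝ)
    (hε : ∀ k, ε k = 1 ∨ ε k = -1) (hε' : ∀ k, ε' k = 1 ∨ ε' k = -1)
    (A : Matrix (Fin n) (Fin n) ℝ) (A' : Matrix (Fin n') (Fin n') ℝ)
    (hA : memLPM ε A) (hA' : memLPM ε' A') :
    memLPM
      (fun k : Fin (n * n') =>
        ∏ j : Fin (k.val + 1),
          Matrix.kroneckerMap (· * ·) (Dmat ε) (Dmat ε')
            (finProdFinEquiv.symm (Fin.castLE k.isLt j))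
            (finProdFinEquiv.symm (Fin.castLE k.isLt j)))
      ((Matrix.kroneckerMap (· * ·) A A').submatrix
        finProdFinEquiv.symm finProdFinEquiv.symm) := by
  obtain ⟨U, d, hU, hU1, hd, hpos⟩ := hA.exists_diagonal
  obtain ⟨U', d', hU', hU1', hd', hpos'⟩ := hA'.exists_diagonal
  set e := (finProdFinEquiv (m := n) (n := n')).symm
  set K := (kroneckerMap (· * ·) A A').submatrix e e with hK
  set W := (kroneckerMap (· * ·) U U').submatrix e e with hW
  have hWU : W.IsUpperTriangular := isUpperTriangular_kronecker_finProdFinEquiv hU hU'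
  have hW1 : ∀ p, W p p = 1 := fun p => by simp [hW, hU1, hU1']
  have hWK : Wᵀ * K * W = diagonal fun p => d (e p).1 * d' (e p).2 := by
    rw [hW, hK, transpose_submatrix, submatrix_mul_equiv, submatrix_mul_equiv]
    rw [← kroneckerMap_transpose, ← mul_kronecker_mul, ← mul_kronecker_mul, hd, hd',
      diagonal_kronecker_diagonal, submatrix_diagonal_equiv]
    rfl
  refine ⟨?_, fun k => ?_⟩
  · rw [IsSymm, hK, transpose_submatrix, ← kroneckerMap_transpose, hA.1.eq, hA'.1.eq]
  · rw [← leadingMinor_transpose_mul_mul K W hWU hW1, hWK, leadingMinor_diagonal,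
      ← Finset.prod_mul_distrib]
    refine Finset.prod_pos fun j _ => ?_
    rw [kroneckerMap_apply, mul_mul_mul_comm]
    exact mul_pos (hpos _) (hpos' _)
end
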